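/- arXiv:math/9312209 — 2 statements merged into one kernel-verified Lean document; each statement's English description precedes it below -/
import Mathlib

section
/- Let K be a separable metric space and let f : K → ℝ be a bounded function of finite Baire index. Then f belongs to SD(K), i.e., f is a strong D-function. -/
open Filter Topology Set

noncomputable section

/-- A real-valued function is bounded. -/
def BddFun {X : Type*} (f : X → ℝ) : Prop := ∃ C, ∀ x, |f x| ≤ C

/-- `f ∈ DBSC(X)`: `f` is a difference of bounded lower semicontinuous functions. -/
def MemDBSC {X : Type*} [TopologicalSpace X] (f : X → ℝ) : Prop :=
  ∃ u v : X → ℝ, BddFun u ∧ BddFun v ∧ LowerSemicontinuous u ∧ LowerSemicontinuous v ∧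
    f = u - v

/-- The D-norm of `f`. -/
def DNorm {X : Type*} [TopologicalSpace X] (f : X → ℝ) : ℝ :=
  sInf {c | ∃ φ : ℕ → X → ℝ, (∀ j, Continuous (φ j)) ∧ (∀ x, Summable fun j => |φ j x|) ∧
    (∀ x, ∑' j, φ j x = f x) ∧ (∀ x, ∑' j, |φ j x| ≤ c)}

/-- The sup-norm of `f`. -/
def supNorm {X : Type*} (f : X → ℝ) : ℝ := ⨆ x, |f x|

/-- A simple D-function: a D-function taking finitely many values. -/
def SimpleD {X : Type*} [TopologicalSpace X] (f : X → ℝ) : Prop :=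
  MemDBSC f ∧ (Set.range f).Finite

/-- `f ∈ SD(X)`: `f` is a strong D-function. -/
def MemSD {X : Type*} [TopologicalSpace X] (f : X → ℝ) : Prop :=
  ∃ φ : ℕ → X → ℝ, (∀ n, SimpleD (φ n)) ∧
    Tendsto (fun n => DNorm (f - φ n)) atTop (𝓝 0)

/-- `f ∈ B_{1/2}(X)`: `f` is a uniform limit of D-functions. -/
def MemBHalf {X : Type*} [TopologicalSpace X] (f : X → ℝ) : Prop :=
  ∃ g : ℕ → X → ℝ, (∀ n, MemDBSC (g n)) ∧ TendstoUniformly g f atTop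

/-- The upper semicontinuous envelope `Uf`. -/
def uEnv {X : Type*} [TopologicalSpace X] (f : X → ℝ) (x : X) : ℝ :=
  sInf {c | ∃ V : Set X, IsOpen V ∧ x ∈ V ∧ sSup (f '' V) = c}

/-- The lower oscillation of `f` at `x`. -/
def losc {X : Type*} [TopologicalSpace X] (f : X → ℝ) (x : X) : ℝ :=
  sInf {c | ∃ V : Set X, IsOpen V ∧ x ∈ V ∧ sSup ((fun y => |f y - f x|) '' V) = c}

/-- The oscillation of `f`: `osc f = U (losc f)`. -/
def osc {X : Type*} [TopologicalSpace X] (f : X → ℝ) : X → ℝ := uEnv (losc f)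

/-- The oscillation sets `os_n(f, ε)`. -/
def osSet {X : Type*} [TopologicalSpace X] (f : X → ℝ) (ε : ℝ) : ℕ → Set X
  | 0 => Set.univ
  | n + 1 => {x | ∃ h : x ∈ osSet f ε n, ε ≤ osc ((osSet f ε n).restrict f) ⟨x, h⟩}

/-- The `ε`-oscillation index `i(f, ε) = sup {n : os_n(f,ε) ≠ ∅}`. -/
def oscIndex {X : Type*} [TopologicalSpace X] (f : X → ℝ) (ε : ℝ) : ℕ∞ :=
  ⨆ (m : ℕ) (_ : (osSet f ε m).Nonempty), (m : ℕ∞)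

/-- `f` has finite Baire index. -/
def FiniteBaireIndex {X : Type*} [TopologicalSpace X] (f : X → ℝ) : Prop :=
  ∃ n : ℕ, ∀ ε > 0, osSet f ε n = ∅

/-- The Baire index `i(f) = sup_{ε > 0} i(f, ε)`. -/
def baireIndex {X : Type*} [TopologicalSpace X] (f : X → ℝ) : ℕ∞ :=
  ⨆ (ε : ℝ) (_ : 0 < ε), oscIndex f ε

open scoped ENNReal

/-- `f` is the pointwise sum of a series of continuous functions whose absolute values have
pointwise sum at most `c`. -/
def HasDSeries {X : Type*} [TopologicalSpace X] (f : X → ℝ) (c : ℝ) : Prop :=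
  ∃ φ : ℕ → X → ℝ, (∀ j, Continuous (φ j)) ∧ (∀ x, Summable fun j => |φ j x|) ∧
    (∀ x, ∑' j, φ j x = f x) ∧ (∀ x, ∑' j, |φ j x| ≤ c)

section DSeries

variable {X : Type*} [TopologicalSpace X]

theorem HasDSeries.mono {f : X → ℝ} {c d : ℝ} (hf : HasDSeries f c) (hcd : c ≤ d) :
    HasDSeries f d := by
  obtain ⟨φ, h1, h2, h3, h4⟩ := hf
  exact ⟨φ, h1, h2, h3, fun x => (h4 x).trans hcd⟩

theorem HasDSeries.zero : HasDSeries (fun _ : X => (0 : ℝ)) 0 :=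
  ⟨fun _ _ => 0, fun _ => continuous_const, fun _ => by simp [summable_zero], by simp, by simp⟩

theorem HasDSeries.neg {f : X → ℝ} {c : ℝ} (hf : HasDSeries f c) :
    HasDSeries (fun x => -f x) c := by
  obtain ⟨φ, h1, h2, h3, h4⟩ := hf
  refine ⟨fun j x => -φ j x, fun j => (h1 j).neg, fun x => ?_, fun x => ?_, fun x => ?_⟩
  · simpa using h2 x
  · rw [tsum_neg, h3]
  · simpa using h4 x

theorem HasDSeries.add {f g : X → ℝ} {c d : ℝ} (hf : HasDSeries f c) (hg : HasDSeries g d) :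
    HasDSeries (fun x => f x + g x) (c + d) := by
  obtain ⟨φ, h1, h2, h3, h4⟩ := hf
  obtain ⟨ψ, k1, k2, k3, k4⟩ := hg
  have hs : ∀ x, Summable fun j => |φ j x + ψ j x| := fun x =>
    Summable.of_nonneg_of_le (fun _ => abs_nonneg _) (fun _ => abs_add_le _ _)
      ((h2 x).add (k2 x))
  refine ⟨fun j x => φ j x + ψ j x, fun j => (h1 j).add (k1 j), hs, fun x => ?_, fun x => ?_⟩
  · rw [(h2 x).of_abs.tsum_add (k2 x).of_abs, h3, k3]
  · calc ∑' j, |φ j x + ψ j x| ≤ ∑' j, (|φ j x| + |ψ j x|) :=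
          (hs x).tsum_le_tsum (fun _ => abs_add_le _ _) ((h2 x).add (k2 x))
      _ = ∑' j, |φ j x| + ∑' j, |ψ j x| := (h2 x).tsum_add (k2 x)
      _ ≤ c + d := add_le_add (h4 x) (k4 x)

theorem HasDSeries.sub {f g : X → ℝ} {c d : ℝ} (hf : HasDSeries f c) (hg : HasDSeries g d) :
    HasDSeries (fun x => f x - g x) (c + d) := by
  simpa only [sub_eq_add_neg] using hf.add hg.neg

theorem HasDSeries.sum_range {g : ℕ → X → ℝ} {c : ℝ} (hg : ∀ m, HasDSeries (g m) c) (N : ℕ) :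
    HasDSeries (fun x => ∑ m ∈ Finset.range N, g m x) (N * c) := by
  induction N with
  | zero => simpa using HasDSeries.zero
  | succ N ih =>
    simp only [Finset.sum_range_succ, Nat.cast_add, Nat.cast_one, add_mul, one_mul]
    exact ih.add (hg N)

theorem HasDSeries.of_hasSum {f : X → ℝ} {g : ℕ → X → ℝ} {c : ℕ → ℝ} {d : ℝ}
    (hg : ∀ k, HasDSeries (g k) (c k)) (hc : HasSum c d)
    (hf : ∀ x, HasSum (fun k => g k x) (f x)) : HasDSeries f d := by
  choose φ h1 h2 h3 h4 using hg
  have hk : ∀ x, Summable fun k => ∑' j, |φ k j x| := fun x =>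
    Summable.of_nonneg_of_le (fun _ => tsum_nonneg fun _ => abs_nonneg _) (fun k => h4 k x)
      hc.summable
  have hs : ∀ x, Summable fun p : ℕ × ℕ => |φ p.1 p.2 x| := fun x =>
    (summable_prod_of_nonneg (fun _ => abs_nonneg _)).2 ⟨fun k => h2 k x, hk x⟩
  let e : ℕ ≃ ℕ × ℕ := Nat.pairEquiv.symm
  refine ⟨fun i => φ (e i).1 (e i).2, fun i => h1 _ _, fun x => ?_, fun x => ?_, fun x => ?_⟩
  · exact (e.summable_iff (f := fun p : ℕ × ℕ => |φ p.1 p.2 x|)).2 (hs x)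
  · rw [e.tsum_eq (fun p : ℕ × ℕ => φ p.1 p.2 x),
      (hs x).of_abs.tsum_prod' fun k => (h2 k x).of_abs]
    simp only [h3]
    exact (hf x).tsum_eq
  · rw [e.tsum_eq (fun p : ℕ × ℕ => |φ p.1 p.2 x|), (hs x).tsum_prod' fun k => h2 k x,
      ← hc.tsum_eq]
    exact (hk x).tsum_le_tsum (fun k => h4 k x) hc.summable

theorem HasDSeries.dNorm_le {f : X → ℝ} {c : ℝ} (hc : 0 ≤ c) (hf : HasDSeries f c) :
    0 ≤ DNorm f ∧ DNorm f ≤ c := by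
  rcases isEmpty_or_nonempty X with hX | ⟨⟨x⟩⟩
  · have : {c | HasDSeries f c} = univ := by
      refine eq_univ_of_forall fun c => ⟨fun _ _ => 0, fun _ => continuous_const, ?_⟩
      simp
    have h0 : DNorm f = 0 := (congrArg sInf this).trans Real.sInf_univ
    exact ⟨h0.ge, h0.le.trans hc⟩
  have h0 : ∀ d, HasDSeries f d → 0 ≤ d := fun d ⟨φ, _, _, _, h4⟩ =>
    (tsum_nonneg fun _ => abs_nonneg _).trans (h4 x)
  exact ⟨le_csInf ⟨c, hf⟩ h0, csInf_le ⟨0, h0⟩ hf⟩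

theorem lowerSemicontinuous_tsum_of_nonneg {ψ : ℕ → X → ℝ} (hψ : ∀ j, Continuous (ψ j))
    (h0 : ∀ j x, 0 ≤ ψ j x) (hs : ∀ x, Summable fun j => ψ j x) :
    LowerSemicontinuous fun x => ∑' j, ψ j x := by
  intro x y hy
  obtain ⟨n, hn⟩ := ((hs x).hasSum.tendsto_sum_nat.eventually (lt_mem_nhds hy)).exists
  have hc : Continuous fun z => ∑ j ∈ Finset.range n, ψ j z :=
    continuous_finsetSum _ fun j _ => hψ j
  filter_upwards [hc.continuousAt.eventually (lt_mem_nhds hn)] with z hz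
  exact hz.trans_le ((hs z).sum_le_tsum _ fun j _ => h0 j z)

theorem HasDSeries.memDBSC {f : X → ℝ} {c : ℝ} (hf : HasDSeries f c) : MemDBSC f := by
  obtain ⟨φ, h1, h2, h3, h4⟩ := hf
  have main : ∀ ψ : ℕ → X → ℝ, (∀ j, Continuous (ψ j)) → (∀ j x, 0 ≤ ψ j x) →
      (∀ j x, ψ j x ≤ |φ j x|) → (∀ x, Summable fun j => ψ j x) ∧
      BddFun (fun x => ∑' j, ψ j x) ∧ LowerSemicontinuous fun x => ∑' j, ψ j x := by
    intro ψ hψ h0 hle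
    have hs : ∀ x, Summable fun j => ψ j x := fun x =>
      Summable.of_nonneg_of_le (fun j => h0 j x) (fun j => hle j x) (h2 x)
    refine ⟨hs, ⟨c, fun x => ?_⟩, lowerSemicontinuous_tsum_of_nonneg hψ h0 hs⟩
    rw [abs_of_nonneg (tsum_nonneg fun j => h0 j x)]
    exact ((hs x).tsum_le_tsum (fun j => hle j x) (h2 x)).trans (h4 x)
  obtain ⟨hs, hb, hl⟩ := main (fun j x => max (φ j x) 0) (fun j => (h1 j).max continuous_const)
    (fun j x => le_max_right _ _) (fun j x => max_le (le_abs_self _) (abs_nonneg _))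
  obtain ⟨hs', hb', hl'⟩ := main (fun j x => max (-φ j x) 0)
    (fun j => (h1 j).neg.max continuous_const)
    (fun j x => le_max_right _ _) (fun j x => max_le (neg_le_abs _) (abs_nonneg _))
  refine ⟨_, _, hb, hb', hl, hl', ?_⟩
  funext x
  rw [Pi.sub_apply, ← (hs x).tsum_sub (hs' x), ← h3 x]
  refine tsum_congr fun j => ?_
  rcases le_total 0 (φ j x) with h | h
  · rw [max_eq_left h, max_eq_right (neg_nonpos.2 h), sub_zero]
  · rw [max_eq_right h, max_eq_left (neg_nonneg.2 h), zero_sub, neg_neg]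

end DSeries

section Metric

variable {K : Type*} [MetricSpace K]

theorem IsOpen.exists_continuous_pos_iff {U : Set K} (hU : IsOpen U) :
    ∃ δ : K → ℝ, Continuous δ ∧ (∀ x, 0 ≤ δ x) ∧ ∀ x, 0 < δ x ↔ x ∈ U := by
  rcases (Uᶜ).eq_empty_or_nonempty with h | h
  · rw [compl_empty_iff] at h
    exact ⟨fun _ => 1, continuous_const, fun _ => zero_le_one, by simp [h]⟩
  · refine ⟨fun x => Metric.infDist x Uᶜ, Metric.continuous_infDist_pt _,
      fun x => Metric.infDist_nonneg, fun x => ?_⟩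
    rw [← hU.isClosed_compl.notMem_iff_infDist_pos h, notMem_compl_iff]

theorem IsOpen.hasDSeries_indicator {U : Set K} (hU : IsOpen U) {h : K → ℝ} {c : ℝ} (hc : 0 ≤ c)
    (hh : ContinuousOn h U) (hb : ∀ x ∈ U, |h x| ≤ c) : HasDSeries (U.indicator h) c := by
  obtain ⟨δ, hδ, hδ0, hδU⟩ := hU.exists_continuous_pos_iff
  set g := U.indicator h with hg
  have hgb : ∀ x, |g x| ≤ c := by
    intro x
    by_cases hx : x ∈ U
    · simpa [hg, hx] using hb x hx
    · simpa [hg, hx] using hc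
  let χ : ℕ → K → ℝ := fun i x => min 1 (i * δ x)
  have hχ : ∀ i, Continuous (χ i) := fun i => continuous_const.min (continuous_const.mul hδ)
  have hχ0 : ∀ i x, 0 ≤ χ i x := fun i x =>
    le_min zero_le_one (mul_nonneg i.cast_nonneg (hδ0 x))
  have hχg : ∀ i, Continuous fun x => χ i x * g x := by
    intro i
    refine continuous_iff_continuousAt.2 fun x => ?_
    by_cases hx : x ∈ U
    · refine (hχ i).continuousAt.mul ?_
      refine (hh.continuousAt (hU.mem_nhds hx)).congr ?_
      filter_upwards [hU.mem_nhds hx] with y hy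
      simp [hg, hy]
    · have hδx : δ x = 0 := le_antisymm (not_lt.1 fun h => hx ((hδU x).1 h)) (hδ0 x)
      have hχx : χ i x = 0 := by simp [χ, hδx]
      have ht : Tendsto (fun y => χ i y * c) (𝓝 x) (𝓝 0) := by
        simpa [hχx] using ((hχ i).mul continuous_const).tendsto x (f := fun y => χ i y * c)
      have : Tendsto (fun y => χ i y * g y) (𝓝 x) (𝓝 0) := by
        refine squeeze_zero_norm (fun y => ?_) ht
        rw [Real.norm_eq_abs, abs_mul, abs_of_nonneg (hχ0 i y)]
        exact mul_le_mul_of_nonneg_left (hgb y) (hχ0 i y)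
      simpa [ContinuousAt, hχx] using this
  have hd0 : ∀ i x, 0 ≤ χ (i + 1) x - χ i x := fun i x => by
    refine sub_nonneg.2 (min_le_min le_rfl (mul_le_mul_of_nonneg_right ?_ (hδ0 x)))
    exact_mod_cast i.le_succ
  have hsum : ∀ x ∈ U, HasSum (fun i => χ (i + 1) x - χ i x) 1 := by
    intro x hx
    have hpos := (hδU x).2 hx
    rw [hasSum_iff_tendsto_nat_of_nonneg fun i => hd0 i x]
    simp only [Finset.sum_range_sub (fun i => χ i x)]
    refine tendsto_const_nhds.congr' ?_
    filter_upwards [(tendsto_natCast_atTop_atTop.atTop_mul_const hpos).eventually_ge_atTop 1]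
      with n hn
    simp [χ, min_eq_left hn]
  have hφ : ∀ x, HasSum (fun i => (χ (i + 1) x - χ i x) * g x) (g x) := by
    intro x
    by_cases hx : x ∈ U
    · simpa using (hsum x hx).mul_right (g x)
    · simp [hg, hx, hasSum_zero]
  have hφa : ∀ x, HasSum (fun i => |(χ (i + 1) x - χ i x) * g x|) |g x| := by
    intro x
    simp only [abs_mul, abs_of_nonneg (hd0 _ x)]
    by_cases hx : x ∈ U
    · simpa using (hsum x hx).mul_right |g x|
    · simp [hg, hx, hasSum_zero]
  refine ⟨fun i x => (χ (i + 1) x - χ i x) * g x, fun i => ?_, fun x => (hφa x).summable,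
    fun x => (hφ x).tsum_eq, fun x => (hφa x).tsum_eq.trans_le (hgb x)⟩
  simp only [sub_mul]
  exact (hχg _).sub (hχg _)

theorem IsOpen.hasDSeries_indicator_inter_isClosed {U M : Set K} (hU : IsOpen U)
    (hM : IsClosed M) {h : K → ℝ} {c : ℝ} (hc : 0 ≤ c) (hh : ContinuousOn h (U ∩ M))
    (hb : ∀ x, |h x| ≤ c) : HasDSeries ((U ∩ M).indicator h) (2 * c) := by
  let s : Set U := {u | (u : K) ∈ M}
  have hs : IsClosed s := hM.preimage continuous_subtype_val
  have hcont : Continuous fun y : s => h ((y : U) : K) :=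
    hh.comp_continuous (continuous_subtype_val.comp continuous_subtype_val)
      fun y => ⟨y.1.2, y.2⟩
  obtain ⟨g, hgb, hgh⟩ := ContinuousMap.exists_restrict_eq_forall_mem_of_closed
    (⟨_, hcont⟩ : C(s, ℝ)) (t := Icc (-c) c) (fun y => abs_le.1 (hb _))
    ⟨0, by simpa using hc⟩ hs
  classical
  let H : K → ℝ := fun x => if hx : x ∈ U then g ⟨x, hx⟩ else 0
  have hHU : ContinuousOn H U := by
    rw [continuousOn_iff_continuous_domRestrict]
    refine g.continuous.congr fun y => ?_
    simp [H]
  have hHb : ∀ x ∈ U, |H x| ≤ c := fun x hx => by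
    simpa [H, hx, abs_le] using hgb ⟨x, hx⟩
  have hHh : ∀ x ∈ U ∩ M, H x = h x := fun x hx => by
    have := DFunLike.congr_fun hgh ⟨⟨x, hx.1⟩, hx.2⟩
    simpa [H, hx.1] using this
  have h1 := hU.hasDSeries_indicator hc hHU hHb
  have h2 := (hU.inter hM.isOpen_compl).hasDSeries_indicator hc (hHU.mono inter_subset_left)
    fun x hx => hHb x hx.1
  rw [two_mul]
  convert h1.sub h2 using 1
  funext x
  by_cases hx : x ∈ U <;> by_cases hx' : x ∈ M <;> simp [hx, hx', hHh]

end Metric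

/-- `φ` is continuous on each level set of an upper semicontinuous rank function with values
in `{0, …, N - 1}`. -/
def LevelwiseContinuous {K : Type*} [TopologicalSpace K] (N : ℕ) (φ : K → ℝ) : Prop :=
  ∃ r : K → ℕ, (∀ x, ∀ᶠ y in 𝓝 x, r y ≤ r x) ∧ (∀ x, r x < N) ∧
    ∀ m, ContinuousOn φ {x | r x = m}

section Levels

variable {K : Type*}

theorem isOpen_setOf_rank_le [TopologicalSpace K] {r : K → ℕ}
    (hr : ∀ x, ∀ᶠ y in 𝓝 x, r y ≤ r x) (m : ℕ) : IsOpen {x | r x ≤ m} :=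
  isOpen_iff_mem_nhds.2 fun x hx => (hr x).mono fun _ hy => hy.trans hx

theorem LevelwiseContinuous.sub [TopologicalSpace K] {N N' : ℕ} {φ ψ : K → ℝ}
    (hφ : LevelwiseContinuous N φ) (hψ : LevelwiseContinuous N' ψ) :
    LevelwiseContinuous (N + N') fun x => φ x - ψ x := by
  obtain ⟨r, hr, hN, hc⟩ := hφ
  obtain ⟨s, hs, hN', hc'⟩ := hψ
  refine ⟨fun x => r x + s x, fun x => ?_, fun x => add_lt_add (hN x) (hN' x), fun m x hx => ?_⟩
  · filter_upwards [hr x, hs x] with y h1 h2 using add_le_add h1 h2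
  · have h1 : {y | r y = r x} ∩ {y | s y = s x} ∈ 𝓝[{y | r y + s y = m}] x := by
      filter_upwards [self_mem_nhdsWithin, mem_nhdsWithin_of_mem_nhds (hr x),
        mem_nhdsWithin_of_mem_nhds (hs x)] with y hy h1 h2
      simp only [mem_ofPred_eq, mem_inter_iff] at *
      omega
    exact (((hc _ x rfl).mono inter_subset_left).sub
      ((hc' _ x rfl).mono inter_subset_right)).mono_of_mem_nhdsWithin h1

theorem LevelwiseContinuous.hasDSeries [MetricSpace K] {N : ℕ} {φ : K → ℝ} {c : ℝ} (hc : 0 ≤ c)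
    (hφ : LevelwiseContinuous N φ) (hb : ∀ x, |φ x| ≤ c) : HasDSeries φ (N * (2 * c)) := by
  obtain ⟨r, hr, hN, hcont⟩ := hφ
  have hlev : ∀ m, {x | r x = m} = {x | r x ≤ m} ∩ {x | m ≤ r x} := fun m => by
    ext x
    exact le_antisymm_iff
  have hclosed : ∀ m, IsClosed {x | m ≤ r x} := fun m => by
    rcases m with _ | m
    · simp
    · convert (isOpen_setOf_rank_le hr m).isClosed_compl using 1
      ext x
      simp
  have h := HasDSeries.sum_range (g := fun m => {x | r x = m}.indicator φ) (c := 2 * c)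
    (fun m => by
      have := hcont m
      rw [hlev] at this ⊢
      exact (isOpen_setOf_rank_le hr m).hasDSeries_indicator_inter_isClosed (hclosed m) hc this hb)
    N
  convert h using 1
  funext x
  rw [Finset.sum_eq_single (r x)]
  · simp
  · intro m _ hm
    simp [hm.symm]
  · intro h
    exact absurd (Finset.mem_range.2 (hN x)) h

theorem LevelwiseContinuous.exists_finite_range_near [TopologicalSpace K] {N : ℕ} {h : K → ℝ}
    (hh : LevelwiseContinuous N h) (hb : BddFun h) {ε : ℝ} (hε : 0 < ε) :
    ∃ φ : K → ℝ, LevelwiseContinuous (2 * N) φ ∧ (range φ).Finite ∧ ∀ x, |h x - φ x| ≤ ε := by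
  obtain ⟨r, hr, hN, hcont⟩ := hh
  obtain ⟨C, hC⟩ := hb
  classical
  let Z : Set K := {x | (⌊h x / ε⌋ : ℝ) = h x / ε}
  let b : K → ℕ := fun x => if x ∈ Z then 1 else 0
  have hb1 : ∀ x, b x ≤ 1 := fun x => by simp only [b]; split_ifs <;> omega
  have hdiv : ∀ m, ContinuousOn (fun x => h x / ε) {x | r x = m} := fun m =>
    (hcont m).div_const ε
  have hfloor : ∀ x, x ∉ Z → ∀ᶠ y in 𝓝[{y | r y = r x}] x,
      ⌊h y / ε⌋ = ⌊h x / ε⌋ ∧ y ∉ Z := by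
    intro x hx
    have hlt : (⌊h x / ε⌋ : ℝ) < h x / ε := lt_of_le_of_ne (Int.floor_le _) hx
    filter_upwards [hdiv _ x rfl (Ioo_mem_nhds hlt (Int.lt_floor_add_one _))] with y hy
    have he : ⌊h y / ε⌋ = ⌊h x / ε⌋ := Int.floor_eq_iff.2 ⟨hy.1.le, hy.2⟩
    refine ⟨he, fun hyZ => ?_⟩
    have : (⌊h y / ε⌋ : ℝ) = h y / ε := hyZ
    rw [he] at this
    exact hy.1.ne this
  refine ⟨fun x => ε * ⌊h x / ε⌋, ⟨fun x => 2 * r x + b x, fun x => ?_, fun x => ?_, ?_⟩,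
    ?_, fun x => ?_⟩
  · have hbx : ∀ᶠ y in 𝓝 x, r y = r x → b y ≤ b x := by
      by_cases hx : x ∈ Z
      · exact Eventually.of_forall fun y _ => by simpa [b, hx] using hb1 y
      · filter_upwards [eventually_nhdsWithin_iff.1 (hfloor x hx)] with y hy hry
        simp [b, (hy hry).2]
    filter_upwards [hr x, hbx] with y h1 h2
    have := hb1 y
    rcases h1.lt_or_eq with h | h
    · omega
    · have := h2 h
      omega
  · have h1 := hN x
    have h2 := hb1 x
    show 2 * r x + b x < 2 * N
    omega
  · intro m x hx
    have hsub : ∀ y ∈ {y | 2 * r y + b y = m}, r y = r x ∧ (y ∈ Z ↔ x ∈ Z) := by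
      intro y hy
      have h1 := hb1 x
      have h2 := hb1 y
      simp only [mem_ofPred_eq] at hx hy
      have hbb : b y = b x := by omega
      refine ⟨by omega, ?_⟩
      by_cases hyZ : y ∈ Z <;> by_cases hxZ : x ∈ Z <;> simp [b, hyZ, hxZ] at hbb ⊢
    by_cases hxZ : x ∈ Z
    · have hval : ∀ y ∈ {y | 2 * r y + b y = m}, ε * (⌊h y / ε⌋ : ℝ) = h y := by
        intro y hy
        have : (⌊h y / ε⌋ : ℝ) = h y / ε := (hsub y hy).2.2 hxZ
        rw [this, mul_div_cancel₀ _ hε.ne']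
      exact ((hcont _ x rfl).mono fun y hy => (hsub y hy).1).congr hval (hval x hx)
    · refine ContinuousWithinAt.congr_of_eventuallyEq
        (continuousWithinAt_const (b := ε * (⌊h x / ε⌋ : ℝ))) ?_ rfl
      filter_upwards [nhdsWithin_mono x (fun y hy => (hsub y hy).1) (hfloor x hxZ)] with y hy
      rw [hy.1]
  · refine ((finite_Icc ⌊-C / ε⌋ ⌊C / ε⌋).image fun z : ℤ => ε * (z : ℝ)).subset ?_
    rintro _ ⟨x, rfl⟩
    have := abs_le.1 (hC x)
    exact ⟨_, ⟨Int.floor_mono (by gcongr; exact this.1), Int.floor_mono (by gcongr; exact this.2)⟩,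
      rfl⟩
  · have h1 : h x = ε * (h x / ε) := (mul_div_cancel₀ _ hε.ne').symm
    have h2 : h x - ε * (⌊h x / ε⌋ : ℝ) = ε * Int.fract (h x / ε) := by
      rw [Int.fract, mul_sub, ← h1]
    rw [h2, abs_of_nonneg (mul_nonneg hε.le (Int.fract_nonneg _))]
    exact mul_le_of_le_one_right hε.le (Int.fract_lt_one _).le

end Levels

section Oscillation

variable {X : Type*} [TopologicalSpace X]

theorem uEnv_nonneg {g : X → ℝ} (hg : ∀ x, 0 ≤ g x) (x : X) : 0 ≤ uEnv g x :=
  Real.sInf_nonneg <| by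
    rintro _ ⟨V, _, _, rfl⟩
    exact Real.sSup_nonneg <| by rintro _ ⟨y, _, rfl⟩; exact hg y

theorem uEnv_le_sSup {g : X → ℝ} (hg : ∀ x, 0 ≤ g x) {x : X} {V : Set X} (hV : IsOpen V)
    (hx : x ∈ V) : uEnv g x ≤ sSup (g '' V) :=
  csInf_le ⟨0, by
    rintro _ ⟨V, _, _, rfl⟩
    exact Real.sSup_nonneg <| by rintro _ ⟨y, _, rfl⟩; exact hg y⟩ ⟨V, hV, hx, rfl⟩

theorem exists_isOpen_of_uEnv_lt {g : X → ℝ} {D ε : ℝ} (hg : ∀ x, 0 ≤ g x) (hD : ∀ x, g x ≤ D)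
    {x : X} (hx : uEnv g x < ε) :
    ∃ V : Set X, IsOpen V ∧ x ∈ V ∧ (∀ y ∈ V, g y < ε) ∧ ∀ y ∈ V, uEnv g y < ε := by
  have hne : {c | ∃ V : Set X, IsOpen V ∧ x ∈ V ∧ sSup (g '' V) = c}.Nonempty :=
    ⟨_, univ, isOpen_univ, mem_univ x, rfl⟩
  obtain ⟨_, ⟨V, hV, hxV, rfl⟩, hlt⟩ := exists_lt_of_csInf_lt hne hx
  exact ⟨V, hV, hxV, fun y hy => (le_csSup ⟨D, by rintro _ ⟨z, _, rfl⟩; exact hD z⟩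
    (mem_image_of_mem g hy)).trans_lt hlt, fun y hy => (uEnv_le_sSup hg hV hy).trans_lt hlt⟩

theorem exists_isOpen_of_osc_lt {g : X → ℝ} {C ε : ℝ} (hC : ∀ x, |g x| ≤ C) {x : X}
    (hx : osc g x < ε) : ∃ V : Set X, IsOpen V ∧ x ∈ V ∧
      (∀ y ∈ V, osc g y < ε) ∧ ∃ W : Set X, IsOpen W ∧ x ∈ W ∧ ∀ y ∈ W, |g y - g x| < ε := by
  have hd : ∀ y z, |g y - g z| ≤ 2 * C := fun y z => by
    have := abs_sub_le (g y) 0 (g z)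
    rw [sub_zero, zero_sub, abs_neg] at this
    linarith [hC y, hC z]
  have hlC : ∀ z, losc g z ≤ 2 * C := fun z =>
    (uEnv_le_sSup (g := fun y => |g y - g z|) (fun _ => abs_nonneg _) isOpen_univ
      (mem_univ z)).trans <| Real.sSup_le (by rintro _ ⟨y, _, rfl⟩; exact hd y z)
        ((abs_nonneg _).trans (hd x x))
  have hl0 : ∀ z, 0 ≤ losc g z := fun z =>
    uEnv_nonneg (g := fun y => |g y - g z|) (fun _ => abs_nonneg _) z
  obtain ⟨V, hV, hxV, hVl, hVo⟩ := exists_isOpen_of_uEnv_lt hl0 hlC hx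
  obtain ⟨W, hW, hxW, hWg, _⟩ := exists_isOpen_of_uEnv_lt (g := fun y => |g y - g x|)
    (fun _ => abs_nonneg _) (fun y => hd y x) (hVl x hxV)
  exact ⟨V, hV, hxV, hVo, W, hW, hxW, hWg⟩

theorem osSet_succ_subset (f : X → ℝ) (ε : ℝ) (n : ℕ) : osSet f ε (n + 1) ⊆ osSet f ε n :=
  fun _ hx => hx.1

theorem exists_isOpen_of_mem_osSet_diff {f : X → ℝ} {C : ℝ} (hC : ∀ x, |f x| ≤ C) {ε : ℝ} {n : ℕ}
    {x : X} (hx : x ∈ osSet f ε n) (hx' : x ∉ osSet f ε (n + 1)) :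
    ∃ V W : Set X, IsOpen V ∧ x ∈ V ∧ (∀ y ∈ V, y ∉ osSet f ε (n + 1)) ∧ IsOpen W ∧ x ∈ W ∧
      ∀ y ∈ W, y ∈ osSet f ε n → |f y - f x| < ε := by
  have hlt : osc ((osSet f ε n).domRestrict f) ⟨x, hx⟩ < ε := not_le.1 fun h => hx' ⟨hx, h⟩
  obtain ⟨V, hV, hxV, hVε, W, hW, hxW, hWε⟩ :=
    exists_isOpen_of_osc_lt (g := (osSet f ε n).domRestrict f) (fun y => hC y) hlt
  obtain ⟨V, hV', rfl⟩ := isOpen_induced_iff.1 hV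
  obtain ⟨W, hW', rfl⟩ := isOpen_induced_iff.1 hW
  exact ⟨V, W, hV', hxV, fun y hy ⟨h, hle⟩ => (hVε ⟨y, h⟩ hy).not_ge hle, hW', hxW,
    fun y hy h => hWε ⟨y, h⟩ hy⟩

theorem isClosed_osSet {f : X → ℝ} (hb : BddFun f) (ε : ℝ) (n : ℕ) : IsClosed (osSet f ε n) := by
  obtain ⟨C, hC⟩ := hb
  induction n with
  | zero => exact isClosed_univ
  | succ n ih =>
    refine isOpen_compl_iff.1 (isOpen_iff_mem_nhds.2 fun x hx => ?_)
    by_cases hxn : x ∈ osSet f ε n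
    · obtain ⟨V, _, hV, hxV, hVn, _⟩ := exists_isOpen_of_mem_osSet_diff hC hxn hx
      exact mem_of_superset (hV.mem_nhds hxV) hVn
    · exact mem_of_superset (ih.isOpen_compl.mem_nhds hxn)
        (compl_subset_compl.2 (osSet_succ_subset f ε n))

theorem exists_rank_of_osSet_eq_empty {f : X → ℝ} (hb : BddFun f) {ε : ℝ} {n : ℕ}
    (hn : osSet f ε n = ∅) : ∃ r : X → ℕ, (∀ x, ∀ᶠ y in 𝓝 x, r y ≤ r x) ∧ (∀ x, r x < n + 1) ∧
      ∀ x, ∀ᶠ y in 𝓝[{y | r y = r x}] x, |f y - f x| < ε := by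
  classical
  have hex : ∀ x, ∃ j, x ∉ osSet f ε (j + 1) := fun x =>
    ⟨n, fun h => by simpa [hn] using osSet_succ_subset f ε n h⟩
  have hmem : ∀ x, x ∈ osSet f ε (Nat.find (hex x)) := fun x => by
    rcases hj : Nat.find (hex x) with _ | j
    · exact mem_univ x
    · exact not_not.1 (Nat.find_min (hex x) (m := j) (by omega))
  have hnmem : ∀ x, x ∉ osSet f ε (Nat.find (hex x) + 1) := fun x => Nat.find_spec (hex x)
  refine ⟨fun x => Nat.find (hex x), fun x => ?_, fun x => Nat.lt_succ_of_le ?_, fun x => ?_⟩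
  · filter_upwards [(isClosed_osSet hb ε _).isOpen_compl.mem_nhds (hnmem x)] with y hy
    exact Nat.find_min' _ hy
  · exact Nat.find_min' _ fun h => by simpa [hn] using osSet_succ_subset f ε n h
  · obtain ⟨C, hC⟩ := hb
    obtain ⟨_, W, _, _, _, hW, hxW, hWε⟩ :=
      exists_isOpen_of_mem_osSet_diff hC (hmem x) (hnmem x)
    filter_upwards [self_mem_nhdsWithin, mem_nhdsWithin_of_mem_nhds (hW.mem_nhds hxW)] with y hy hyW
    have hy' : Nat.find (hex y) = Nat.find (hex x) := hy
    exact hWε y hyW (hy' ▸ hmem y)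

end Oscillation

section Approximation

variable {K : Type*} [MetricSpace K]

theorem exists_continuousOn_near {f : K → ℝ} {S : Set K} {ε : ℝ}
    (hS : ∀ x ∈ S, ∀ᶠ y in 𝓝[S] x, |f y - f x| < ε) :
    ∃ g : K → ℝ, ContinuousOn g S ∧ ∀ x ∈ S, |f x - g x| ≤ ε := by
  obtain ⟨g, hg⟩ := exists_continuous_forall_mem_convex_of_local_const (X := S) (E := ℝ)
    (t := fun x => Metric.closedBall (f x) ε) (fun x => convex_closedBall _ _) fun x =>
      ⟨f x, by
        have := hS x x.2
        rw [← map_nhds_subtype_val x, eventually_map] at this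
        filter_upwards [this] with y hy
        rw [Metric.mem_closedBall', Real.dist_eq]
        exact hy.le⟩
  classical
  refine ⟨fun x => if hx : x ∈ S then g ⟨x, hx⟩ else 0, ?_, fun x hx => ?_⟩
  · rw [continuousOn_iff_continuous_domRestrict]
    refine g.continuous.congr fun y => ?_
    simp
  · simpa [hx, Real.dist_eq] using Metric.mem_closedBall'.1 (hg ⟨x, hx⟩)

theorem exists_levelwiseContinuous_near {f : K → ℝ} (hb : BddFun f) {ε : ℝ} {n : ℕ}
    (hn : osSet f ε n = ∅) :
    ∃ h : K → ℝ, LevelwiseContinuous (n + 1) h ∧ ∀ x, |f x - h x| ≤ ε := by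
  obtain ⟨r, hr, hN, hosc⟩ := exists_rank_of_osSet_eq_empty hb hn
  have : ∀ m, ∃ g : K → ℝ, ContinuousOn g {x | r x = m} ∧ ∀ x ∈ {x | r x = m}, |f x - g x| ≤ ε :=
    fun m => exists_continuousOn_near fun x hx => by
      have hx : r x = m := hx
      exact hx ▸ hosc x
  choose g hg hgf using this
  refine ⟨fun x => g (r x) x, ⟨r, hr, hN, fun m => (hg m).congr fun x hx => ?_⟩,
    fun x => hgf _ x rfl⟩
  rw [mem_ofPred_eq] at hx
  simp only [hx]

theorem exists_finite_range_near {f : K → ℝ} (hb : BddFun f) {ε : ℝ} (hε : 0 < ε) {n : ℕ}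
    (hn : osSet f ε n = ∅) : ∃ φ : K → ℝ, LevelwiseContinuous (2 * (n + 1)) φ ∧
      (range φ).Finite ∧ ∀ x, |f x - φ x| ≤ 2 * ε := by
  obtain ⟨h, hh, hfh⟩ := exists_levelwiseContinuous_near hb hn
  obtain ⟨C, hC⟩ := hb
  have hhb : BddFun h := ⟨C + ε, fun x => by
    have h1 := abs_le.1 (hfh x)
    have h2 := abs_le.1 (hC x)
    exact abs_le.2 ⟨by linarith [h1.2, h2.1], by linarith [h1.1, h2.2]⟩⟩
  obtain ⟨φ, hφ, hfin, hφh⟩ := hh.exists_finite_range_near hhb hε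
  refine ⟨φ, hφ, hfin, fun x => (abs_sub_le _ (h x) _).trans ?_⟩
  linarith [hfh x, hφh x]

theorem LevelwiseContinuous.simpleD {N : ℕ} {φ : K → ℝ} (hφ : LevelwiseContinuous N φ)
    (hfin : (range φ).Finite) : SimpleD φ := by
  obtain ⟨C, hC⟩ := (hfin.image fun t => |t|).bddAbove
  have hb : ∀ x, |φ x| ≤ max C 0 := fun x =>
    (hC ⟨φ x, mem_range_self x, rfl⟩).trans (le_max_left _ _)
  exact ⟨(hφ.hasDSeries (le_max_right _ _) hb).memDBSC, hfin⟩

end Approximation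

/-- **Theorem 1.2.** Every bounded function of finite Baire index on a separable
metric space belongs to `SD(K)`. -/
theorem finite_baire_index_mem_SD {K : Type*} [MetricSpace K]
    [TopologicalSpace.SeparableSpace K] (f : K → ℝ) (hb : BddFun f)
    (hfin : FiniteBaireIndex f) : MemSD f := by
  obtain ⟨n, hn⟩ := hfin
  have hpos : ∀ k : ℕ, (0 : ℝ) < (1 / 2) ^ k := fun k => by positivity
  choose φ hφ hφfin hφf using fun k => exists_finite_range_near hb (hpos k) (hn _ (hpos k))
  refine ⟨φ, fun k => (hφ k).simpleD (hφfin k), ?_⟩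
  let N : ℕ := 2 * (n + 1) + 2 * (n + 1)
  have hstep : ∀ k m, HasDSeries (fun x => φ (k + m + 1) x - φ (k + m) x)
      (N * (2 * (4 * (1 / 2) ^ (k + m)))) := fun k m => by
    refine ((hφ (k + m + 1)).sub (hφ (k + m))).hasDSeries (by positivity) fun x => ?_
    have h1 := abs_le.1 (hφf (k + m + 1) x)
    have h2 := abs_le.1 (hφf (k + m) x)
    have h3 := hpos (k + m)
    rw [pow_succ] at h1
    exact abs_le.2 ⟨by linarith [h1.2, h2.1], by linarith [h1.1, h2.2]⟩
  have hlim : ∀ x, Tendsto (fun k => φ k x) atTop (𝓝 (f x)) := fun x => by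
    have h0 : Tendsto (fun k : ℕ => 2 * (1 / 2 : ℝ) ^ k) atTop (𝓝 0) := by
      simpa using (tendsto_pow_atTop_nhds_zero_of_lt_one (r := (1 / 2 : ℝ))
        (by norm_num) (by norm_num)).const_mul 2
    refine tendsto_iff_dist_tendsto_zero.2 (squeeze_zero (fun _ => dist_nonneg) (fun k => ?_) h0)
    rw [dist_comm, Real.dist_eq]
    exact hφf k x
  have htail : ∀ k, HasDSeries (f - φ k) (16 * N * (1 / 2) ^ k) := fun k => by
    refine HasDSeries.of_hasSum (hstep k) ?_ fun x => ?_
    · have := hasSum_geometric_two.mul_left (8 * N * (1 / 2 : ℝ) ^ k)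
      rw [show 8 * N * (1 / 2 : ℝ) ^ k * 2 = 16 * N * (1 / 2) ^ k by ring] at this
      refine this.congr_fun fun m => ?_
      rw [pow_add]
      ring
    · have hsummable : Summable fun m => φ (k + m + 1) x - φ (k + m) x := by
        refine Summable.of_norm_bounded (g := fun m => 4 * (1 / 2 : ℝ) ^ (k + m)) ?_ fun m => ?_
        · simp only [pow_add, ← mul_assoc]
          exact summable_geometric_two.mul_left _
        · have h1 := abs_le.1 (hφf (k + m + 1) x)
          have h2 := abs_le.1 (hφf (k + m) x)
          have h3 := hpos (k + m)
          rw [pow_succ] at h1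
          exact abs_le.2 ⟨by linarith [h1.2, h2.1], by linarith [h1.1, h2.2]⟩
      refine hsummable.hasSum_iff_tendsto_nat.2 ?_
      have : ∀ M, ∑ m ∈ Finset.range M, (φ (k + m + 1) x - φ (k + m) x) = φ (M + k) x - φ k x :=
        fun M => by
          simpa only [add_comm M k, add_zero, ← add_assoc] using
            Finset.sum_range_sub (fun m => φ (k + m) x) M
      simp only [this]
      exact ((tendsto_add_atTop_iff_nat k).2 (hlim x)).sub_const _
  have hb' := fun k => (htail k).dNorm_le (by positivity)
  refine squeeze_zero (fun k => (hb' k).1) (fun k => (hb' k).2) ?_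
  simpa using (tendsto_pow_atTop_nhds_zero_of_lt_one (r := (1 / 2 : ℝ))
    (by norm_num) (by norm_num)).const_mul (16 * (N : ℝ))
end
end

section
/- Let K be a separable metric space, n ≥ 0, and let f : K → ℝ be a bounded function for which there exists an open set U ⊂ K such that f is supported on U (f vanishes off U) and the restriction f|_U has Baire index i(f|_U) ≤ n. Then f ∈ SD(K) and ‖f‖_D ≤ (2^{n+1} − 1)·‖f‖_∞. -/
open Filter Topology Set

noncomputable section

open scoped ENNReal

/-- `f` is a difference of nonnegative lower semicontinuous functions whose sum is at most `c`.
On a metric space this bounds the D-norm of `f` by `c`. -/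
def DBound {X : Type*} [TopologicalSpace X] (f : X → ℝ) (c : ℝ) : Prop :=
  ∃ u v : X → ℝ, LowerSemicontinuous u ∧ LowerSemicontinuous v ∧ (∀ x, 0 ≤ u x) ∧
    (∀ x, 0 ≤ v x) ∧ (∀ x, f x = u x - v x) ∧ ∀ x, u x + v x ≤ c

section Semicontinuity

variable {X : Type*} [TopologicalSpace X]

theorem LowerSemicontinuousOn.indicator_of_nonneg {W : Set X} (hW : IsOpen W) {g : X → ℝ}
    (hg : LowerSemicontinuousOn g W) (h0 : ∀ x ∈ W, 0 ≤ g x) :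
    LowerSemicontinuous (W.indicator g) := by
  have hnn : ∀ z, 0 ≤ W.indicator g z := fun z => indicator_nonneg h0 z
  intro x y hy
  by_cases hx : x ∈ W
  · rw [indicator_of_mem hx] at hy
    have := hg x hx y hy
    rw [hW.nhdsWithin_eq hx] at this
    filter_upwards [this, hW.mem_nhds hx] with z hz hzW
    rwa [indicator_of_mem hzW]
  · rw [indicator_of_notMem hx] at hy
    exact Eventually.of_forall fun z => hy.trans_le (hnn z)

theorem lowerSemicontinuous_of_hasSum {u : ℕ → X → ℝ} (hu : ∀ k, LowerSemicontinuous (u k))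
    (h0 : ∀ k x, 0 ≤ u k x) {s : X → ℝ} (hs : ∀ x, HasSum (fun k => u k x) (s x)) :
    LowerSemicontinuous s := by
  intro x y hy
  obtain ⟨F, hF⟩ := ((hs x).eventually_const_lt hy).exists
  have hl : LowerSemicontinuous fun z => ∑ k ∈ F, u k z :=
    lowerSemicontinuous_sum fun k _ => hu k
  filter_upwards [hl x y hF] with z hz
  exact hz.trans_le (sum_le_hasSum F (fun k _ => h0 k z) (hs z))

end Semicontinuity

section MetricApproximation

variable {X : Type*} [PseudoMetricSpace X]

theorem continuous_iInf_add_mul_dist {u : X → ℝ} (h0 : ∀ x, 0 ≤ u x) {r : ℝ} (hr : 0 ≤ r) :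
    Continuous fun x => ⨅ y, (u y + r * dist x y) := by
  have hbdd : ∀ x, BddBelow (range fun y => u y + r * dist x y) := fun x =>
    ⟨0, by rintro _ ⟨y, rfl⟩; have := h0 y; positivity⟩
  refine (LipschitzWith.of_le_add_mul (Real.toNNReal r) fun x z => ?_).continuous
  have : Nonempty X := ⟨x⟩
  rw [Real.coe_toNNReal r hr, ← sub_le_iff_le_add]
  refine le_ciInf fun y => ?_
  have h1 : (⨅ y, (u y + r * dist x y)) ≤ u y + r * dist x y := ciInf_le (hbdd x) y
  have h2 : r * dist x y ≤ r * (dist x z + dist z y) :=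
    mul_le_mul_of_nonneg_left (dist_triangle x z y) hr
  linarith

/-- A nonnegative lower semicontinuous function on a metric space is the sum of a series of
nonnegative continuous functions. -/
theorem LowerSemicontinuous.exists_hasSum_continuous {u : X → ℝ} (hu : LowerSemicontinuous u)
    (h0 : ∀ x, 0 ≤ u x) :
    ∃ a : ℕ → X → ℝ, (∀ j, Continuous (a j)) ∧ (∀ j x, 0 ≤ a j x) ∧
      ∀ x, HasSum (fun j => a j x) (u x) := by
  set b : ℕ → X → ℝ := fun n x => min (n : ℝ) (⨅ y, (u y + n * dist x y)) with hb
  have hbdd : ∀ (n : ℕ) x, BddBelow (range fun y => u y + n * dist x y) := fun n x =>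
    ⟨0, by rintro _ ⟨y, rfl⟩; have := h0 y; positivity⟩
  have hbc : ∀ n, Continuous (b n) := fun n =>
    continuous_const.min (continuous_iInf_add_mul_dist h0 n.cast_nonneg)
  have hmono : ∀ n x, b n x ≤ b (n + 1) x := fun n x => by
    have : Nonempty X := ⟨x⟩
    refine min_le_min (by simp) (ciInf_mono (hbdd n x) fun y => ?_)
    have : (n : ℝ) * dist x y ≤ ((n + 1 : ℕ) : ℝ) * dist x y := by
      gcongr; simp
    linarith
  have hzero : ∀ x, b 0 x = 0 := fun x => by
    have : Nonempty X := ⟨x⟩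
    simp only [hb, Nat.cast_zero, zero_mul, add_zero]
    exact min_eq_left (le_ciInf h0)
  have hle : ∀ n x, b n x ≤ u x := fun n x =>
    (min_le_right _ _).trans ((ciInf_le (hbdd n x) x).trans (by simp))
  have hlim : ∀ x, Tendsto (fun n => b n x) atTop (𝓝 (u x)) := fun x => by
    have : Nonempty X := ⟨x⟩
    refine tendsto_order.2 ⟨fun t ht => ?_, fun t ht =>
      Eventually.of_forall fun n => (hle n x).trans_lt ht⟩
    obtain ⟨s, hts, hsu⟩ := exists_between ht
    obtain ⟨δ, hδ, hball⟩ := Metric.eventually_nhds_iff.1 (hu x s hsu)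
    filter_upwards [eventually_ge_atTop ⌈s⌉₊, eventually_ge_atTop ⌈s / δ⌉₊] with n hn1 hn2
    refine hts.trans_le (le_min (Nat.ceil_le.1 hn1) (le_ciInf fun y => ?_))
    rcases lt_or_ge (dist y x) δ with h | h
    · have := (hball h).le
      have : 0 ≤ (n : ℝ) * dist x y := by positivity
      linarith
    · have h1 : s ≤ n * δ := (div_le_iff₀ hδ).1 (Nat.ceil_le.1 hn2)
      have h2 : (n : ℝ) * δ ≤ n * dist x y := by rw [dist_comm x y]; gcongr
      linarith [h0 y]
  refine ⟨fun j x => b (j + 1) x - b j x, fun j => (hbc _).sub (hbc _),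
    fun j x => sub_nonneg.2 (hmono j x), fun x => ?_⟩
  rw [hasSum_iff_tendsto_nat_of_nonneg fun j => sub_nonneg.2 (hmono j x)]
  simpa only [Finset.sum_range_sub (fun n => b n x), hzero, sub_zero] using hlim x

end MetricApproximation

theorem DNorm_of_isEmpty {X : Type*} [TopologicalSpace X] [h : IsEmpty X] (f : X → ℝ) :
    DNorm f = 0 := by
  have : {c | ∃ φ : ℕ → X → ℝ, (∀ j, Continuous (φ j)) ∧ (∀ x, Summable fun j => |φ j x|) ∧
      (∀ x, ∑' j, φ j x = f x) ∧ (∀ x, ∑' j, |φ j x| ≤ c)} = univ :=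
    eq_univ_of_forall fun c => ⟨0, fun j => continuous_const, fun x => h.elim x,
      fun x => h.elim x, fun x => h.elim x⟩
  rw [DNorm, this, Real.sInf_univ]

theorem DNorm_nonneg {X : Type*} [TopologicalSpace X] (f : X → ℝ) : 0 ≤ DNorm f := by
  rcases isEmpty_or_nonempty X with h | ⟨⟨x⟩⟩
  · rw [DNorm_of_isEmpty]
  · refine Real.sInf_nonneg ?_
    rintro c ⟨φ, -, -, -, h⟩
    exact (tsum_nonneg fun j => abs_nonneg _).trans (h x)

namespace DBound

section Topological

variable {X : Type*} [TopologicalSpace X] {f g : X → ℝ} {c d : ℝ}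

theorem abs_le (hf : DBound f c) (x : X) : |f x| ≤ c := by
  obtain ⟨u, v, -, -, hu0, hv0, hfe, hc⟩ := hf
  have h1 := hu0 x
  have h2 := hv0 x
  have h3 := hc x
  rw [hfe x, _root_.abs_le]
  constructor <;> linarith

theorem mono (hf : DBound f c) (h : c ≤ d) : DBound f d := by
  obtain ⟨u, v, hu, hv, hu0, hv0, hfe, hc⟩ := hf
  exact ⟨u, v, hu, hv, hu0, hv0, hfe, fun x => (hc x).trans h⟩

theorem zero (hc : 0 ≤ c) : DBound (0 : X → ℝ) c :=
  ⟨0, 0, lowerSemicontinuous_const, lowerSemicontinuous_const, fun _ => le_rfl, fun _ => le_rfl,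
    fun _ => by simp, fun _ => by simpa using hc⟩

theorem neg (hf : DBound f c) : DBound (-f) c := by
  obtain ⟨u, v, hu, hv, hu0, hv0, hfe, hc⟩ := hf
  exact ⟨v, u, hv, hu, hv0, hu0, fun x => by simp [hfe x], fun x => by linarith [hc x]⟩

theorem add (hf : DBound f c) (hg : DBound g d) : DBound (f + g) (c + d) := by
  obtain ⟨u, v, hu, hv, hu0, hv0, hfe, hc⟩ := hf
  obtain ⟨u', v', hu', hv', hu0', hv0', hfe', hc'⟩ := hg
  exact ⟨fun x => u x + u' x, fun x => v x + v' x, hu.add hu', hv.add hv',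
    fun x => add_nonneg (hu0 x) (hu0' x), fun x => add_nonneg (hv0 x) (hv0' x),
    fun x => by rw [Pi.add_apply, hfe x, hfe' x]; ring, fun x => by linarith [hc x, hc' x]⟩

theorem memDBSC (hf : DBound f c) : MemDBSC f := by
  obtain ⟨u, v, hu, hv, hu0, hv0, hfe, hc⟩ := hf
  exact ⟨u, v, ⟨c, fun x => by rw [abs_of_nonneg (hu0 x)]; linarith [hc x, hv0 x]⟩,
    ⟨c, fun x => by rw [abs_of_nonneg (hv0 x)]; linarith [hc x, hu0 x]⟩, hu, hv, funext hfe⟩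

theorem of_hasSum {h : ℕ → X → ℝ} {c : ℕ → ℝ} {C : ℝ} (hh : ∀ k, DBound (h k) (c k))
    (hc : HasSum c C) : DBound (fun x => ∑' k, h k x) C := by
  choose u v hu hv hu0 hv0 hfe hle using hh
  have hsu : ∀ x, Summable fun k => u k x := fun x =>
    hc.summable.of_nonneg_of_le (fun k => hu0 k x) fun k => by linarith [hle k x, hv0 k x]
  have hsv : ∀ x, Summable fun k => v k x := fun x =>
    hc.summable.of_nonneg_of_le (fun k => hv0 k x) fun k => by linarith [hle k x, hu0 k x]
  refine ⟨fun x => ∑' k, u k x, fun x => ∑' k, v k x,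
    lowerSemicontinuous_of_hasSum hu hu0 fun x => (hsu x).hasSum,
    lowerSemicontinuous_of_hasSum hv hv0 fun x => (hsv x).hasSum,
    fun x => tsum_nonneg fun k => hu0 k x, fun x => tsum_nonneg fun k => hv0 k x,
    fun x => ?_, fun x => ?_⟩
  · simp only [hfe]
    exact (hsu x).tsum_sub (hsv x)
  · exact hasSum_le (fun k => hle k x) ((hsu x).hasSum.add (hsv x).hasSum) hc

/-- A function continuous on an open set and vanishing off it has D-norm equal to its
sup-norm. -/
theorem of_continuousOn {W : Set X} (hW : IsOpen W) (hf : ContinuousOn f W)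
    (hf0 : ∀ x ∉ W, f x = 0) (hc : ∀ x, |f x| ≤ c) : DBound f c := by
  refine ⟨W.indicator fun x => max (f x) 0, W.indicator fun x => max (-f x) 0,
    LowerSemicontinuousOn.indicator_of_nonneg hW
      (hf.sup continuousOn_const).lowerSemicontinuousOn fun _ _ => le_max_right _ _,
    LowerSemicontinuousOn.indicator_of_nonneg hW
      (hf.neg.sup continuousOn_const).lowerSemicontinuousOn fun _ _ => le_max_right _ _,
    indicator_nonneg fun _ _ => le_max_right _ _, indicator_nonneg fun _ _ => le_max_right _ _,
    fun x => ?_, fun x => ?_⟩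
  all_goals by_cases hx : x ∈ W
  · simp only [indicator_of_mem hx]
    rcases le_total 0 (f x) with h | h <;> simp [h]
  · simp [indicator_of_notMem hx, hf0 x hx]
  · simp only [indicator_of_mem hx]
    refine le_trans (le_of_eq ?_) (hc x)
    rcases le_total 0 (f x) with h | h <;> simp [h, abs_of_nonneg, abs_of_nonpos]
  · simpa [indicator_of_notMem hx] using (abs_nonneg _).trans (hc x)

/-- A bounded function continuous on an open set and vanishing off it can be approximated in
D-norm by finitely valued functions. -/
theorem exists_finite_range_of_continuousOn {W : Set X} (hW : IsOpen W) (hf : ContinuousOn f W)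
    (hf0 : ∀ x ∉ W, f x = 0) (hc : ∀ x, |f x| ≤ c) {ε : ℝ} (hε : 0 < ε) :
    ∃ φ : X → ℝ, (range φ).Finite ∧ DBound (f - φ) (ε + ε) := by
  refine ⟨W.indicator fun x => ε * (⌈f x / ε⌉ - 1), ?_, W.indicator fun _ => ε,
    W.indicator fun x => ε * ⌈f x / ε⌉ - f x, ?_, ?_, ?_, ?_, fun x => ?_, fun x => ?_⟩
  · have hfin : ((fun m : ℤ => ε * ((m : ℝ) - 1)) '' Icc (-⌈c / ε⌉) ⌈c / ε⌉ ∪ {0}).Finite :=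
      ((finite_Icc _ _).image _).union (finite_singleton _)
    refine hfin.subset ?_
    rintro _ ⟨x, rfl⟩
    by_cases hx : x ∈ W
    · left
      refine ⟨⌈f x / ε⌉, ⟨?_, ?_⟩, (indicator_of_mem hx fun x => ε * ((⌈f x / ε⌉ : ℝ) - 1)).symm⟩
      · have h1 : -c ≤ f x := (_root_.abs_le.1 (hc x)).1
        have h2 : -(c / ε) ≤ f x / ε := by rw [← neg_div]; gcongr
        have h3 : (-⌈c / ε⌉ : ℝ) ≤ ⌈f x / ε⌉ := by
          linarith [Int.le_ceil (c / ε), Int.le_ceil (f x / ε)]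
        exact_mod_cast h3
      · exact Int.ceil_mono (by gcongr; exact (_root_.abs_le.1 (hc x)).2)
    · right
      exact indicator_of_notMem hx _
  · exact LowerSemicontinuousOn.indicator_of_nonneg hW
      continuousOn_const.lowerSemicontinuousOn fun _ _ => hε.le
  · refine LowerSemicontinuousOn.indicator_of_nonneg hW (fun x hx y hy => ?_) fun x _ => ?_
    · have h1 : ∀ᶠ z in 𝓝[W] x, (⌈f x / ε⌉ : ℝ) - 1 < f z / ε :=
        ((hf x hx).div_const ε).eventually_const_lt
          (by linarith [Int.ceil_lt_add_one (f x / ε)])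
      have h2 : ∀ᶠ z in 𝓝[W] x, f z < ε * ⌈f x / ε⌉ - y :=
        (hf x hx).eventually_lt_const (by linarith)
      filter_upwards [h1, h2] with z hz1 hz2
      have h3 : ⌈f x / ε⌉ - 1 < ⌈f z / ε⌉ := Int.lt_ceil.2 (by push_cast; exact hz1)
      have h4 : (⌈f x / ε⌉ : ℝ) ≤ ⌈f z / ε⌉ := by exact_mod_cast Int.sub_one_lt_iff.1 h3
      have := mul_le_mul_of_nonneg_left h4 hε.le
      linarith
    · have := (div_le_iff₀ hε).1 (Int.le_ceil (f x / ε))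
      linarith
  · exact indicator_nonneg fun _ _ => hε.le
  · refine indicator_nonneg fun x _ => ?_
    have := (div_le_iff₀ hε).1 (Int.le_ceil (f x / ε))
    linarith
  · by_cases hx : x ∈ W
    · simp only [Pi.sub_apply, indicator_of_mem hx]; ring
    · simp [indicator_of_notMem hx, hf0 x hx]
  · by_cases hx : x ∈ W
    · simp only [indicator_of_mem hx]
      have h1 : (⌈f x / ε⌉ : ℝ) - 1 ≤ f x / ε := by linarith [Int.ceil_lt_add_one (f x / ε)]
      have := (le_div_iff₀ hε).1 h1
      linarith
    · simp only [indicator_of_notMem hx]; linarith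

end Topological

theorem DNorm_le {X : Type*} [PseudoMetricSpace X] {f : X → ℝ} {c : ℝ} (hf : DBound f c)
    (hc : 0 ≤ c) : DNorm f ≤ c := by
  obtain ⟨u, v, hu, hv, hu0, hv0, hfe, hle⟩ := hf
  obtain ⟨a, hac, ha0, ha⟩ := hu.exists_hasSum_continuous hu0
  obtain ⟨b, hbc, hb0, hb⟩ := hv.exists_hasSum_continuous hv0
  have habs : ∀ j x, |a j x - b j x| ≤ a j x + b j x := fun j x =>
    abs_le'.2 ⟨by linarith [hb0 j x], by linarith [ha0 j x]⟩
  have hs : ∀ x, Summable fun j => |a j x - b j x| := fun x =>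
    ((ha x).add (hb x)).summable.of_nonneg_of_le (fun j => abs_nonneg _) fun j => habs j x
  rcases isEmpty_or_nonempty X with h | ⟨⟨x₀⟩⟩
  · rwa [DNorm_of_isEmpty]
  · refine csInf_le ⟨0, ?_⟩ ⟨fun j x => a j x - b j x, fun j => (hac j).sub (hbc j), hs,
      fun x => ?_, fun x => ?_⟩
    · rintro d ⟨φ, -, -, -, h⟩
      exact (tsum_nonneg fun j => abs_nonneg _).trans (h x₀)
    · rw [hfe]
      exact ((ha x).sub (hb x)).tsum_eq
    · exact (hasSum_le (fun j => habs j x) (hs x).hasSum ((ha x).add (hb x))).trans (hle x)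

end DBound

/-- `f` is approximated in D-norm by functions with finitely many values. -/
def DApprox {X : Type*} [TopologicalSpace X] (f : X → ℝ) : Prop :=
  ∀ ε > 0, ∃ φ : X → ℝ, (range φ).Finite ∧ DBound (f - φ) ε

namespace DApprox

variable {X : Type*} [TopologicalSpace X] {f g : X → ℝ}

theorem zero : DApprox (0 : X → ℝ) := fun ε hε =>
  ⟨0, (finite_singleton (0 : ℝ)).subset (range_subset_iff.2 fun _ => rfl), by
    rw [sub_zero]; exact DBound.zero hε.le⟩

theorem add (hf : DApprox f) (hg : DApprox g) : DApprox (f + g) := fun ε hε => by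
  obtain ⟨φ, hφ, hfφ⟩ := hf (ε / 2) (half_pos hε)
  obtain ⟨ψ, hψ, hgψ⟩ := hg (ε / 2) (half_pos hε)
  refine ⟨φ + ψ, (Set.Finite.image2 (· + ·) hφ hψ).subset ?_, ?_⟩
  · rintro _ ⟨x, rfl⟩
    exact mem_image2_of_mem (mem_range_self x) (mem_range_self x)
  · have := hfφ.add hgψ
    rwa [add_halves, sub_add_sub_comm] at this

theorem sum_range {h : ℕ → X → ℝ} (hh : ∀ k, DApprox (h k)) (N : ℕ) :
    DApprox (∑ k ∈ Finset.range N, h k) := by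
  induction N with
  | zero => simpa using zero
  | succ N ih => rw [Finset.sum_range_succ]; exact ih.add (hh N)

theorem of_forall_dBound_sub (h : ∀ ε > 0, ∃ g, DApprox g ∧ DBound (f - g) ε) : DApprox f :=
  fun ε hε => by
    obtain ⟨g, hg, hfg⟩ := h (ε / 2) (half_pos hε)
    obtain ⟨φ, hφ, hgφ⟩ := hg (ε / 2) (half_pos hε)
    refine ⟨φ, hφ, ?_⟩
    have := hfg.add hgφ
    rwa [add_halves, sub_add_sub_cancel] at this

end DApprox

/-- `f` is a strong D-function of D-norm at most `c`, continuous off `L`. -/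
structure StrongDOff {X : Type*} [TopologicalSpace X] (L : Set X) (f : X → ℝ) (c : ℝ) :
    Prop where
  continuousOn : ContinuousOn f Lᶜ
  dBound : DBound f c
  dApprox : DApprox f

namespace StrongDOff

variable {X : Type*} [TopologicalSpace X] {L L' : Set X} {f g : X → ℝ} {c d : ℝ}

theorem mono (hf : StrongDOff L f c) (hL : L ⊆ L') (hc : c ≤ d) : StrongDOff L' f d :=
  ⟨hf.continuousOn.mono (compl_subset_compl.2 hL), hf.dBound.mono hc, hf.dApprox⟩

theorem zero (hc : 0 ≤ c) : StrongDOff L (0 : X → ℝ) c :=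
  ⟨continuousOn_const, DBound.zero hc, DApprox.zero⟩

theorem add (hf : StrongDOff L f c) (hg : StrongDOff L g d) : StrongDOff L (f + g) (c + d) :=
  ⟨hf.continuousOn.add hg.continuousOn, hf.dBound.add hg.dBound, hf.dApprox.add hg.dApprox⟩

theorem of_continuousOn (hL : IsClosed L) (hf : ContinuousOn f Lᶜ) (hf0 : ∀ x ∈ L, f x = 0)
    (hc : ∀ x, |f x| ≤ c) : StrongDOff L f c where
  continuousOn := hf
  dBound := DBound.of_continuousOn hL.isOpen_compl hf (fun x hx => hf0 x (not_not.1 hx)) hc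
  dApprox := fun ε hε => by
    have := DBound.exists_finite_range_of_continuousOn hL.isOpen_compl hf
      (fun x hx => hf0 x (not_not.1 hx)) hc (half_pos hε)
    rwa [add_halves] at this

theorem hasSum_apply {h : ℕ → X → ℝ} {c : ℕ → ℝ} (hh : ∀ k, StrongDOff L (h k) (c k))
    (hc : Summable c) (x : X) : HasSum (fun k => h k x) (∑' k, h k x) :=
  (hc.of_norm_bounded fun k => (hh k).dBound.abs_le x).hasSum

theorem of_hasSum {h : ℕ → X → ℝ} {c : ℕ → ℝ} {C : ℝ} (hh : ∀ k, StrongDOff L (h k) (c k))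
    (hc : HasSum c C) : StrongDOff L (fun x => ∑' k, h k x) C where
  continuousOn := continuousOn_tsum (fun k => (hh k).continuousOn) hc.summable
    fun k x _ => (hh k).dBound.abs_le x
  dBound := DBound.of_hasSum (fun k => (hh k).dBound) hc
  dApprox := DApprox.of_forall_dBound_sub fun ε hε => by
    obtain ⟨N, hN⟩ := (hc.tendsto_sum_nat.eventually_const_lt (sub_lt_self C hε)).exists
    refine ⟨_, DApprox.sum_range (fun k => (hh k).dApprox) N, ?_⟩
    have htail := DBound.of_hasSum (fun k => (hh (k + N)).dBound) ((hasSum_nat_add_iff' N).2 hc)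
    convert htail.mono (by linarith : _ ≤ ε) using 1
    funext x
    rw [Pi.sub_apply, Finset.sum_apply, sub_eq_iff_eq_add']
    exact ((hasSum_apply hh hc.summable x).summable.sum_add_tsum_nat_add N).symm

/-- If every function satisfying `P M` is, up to a function satisfying `P ε` with `ε`
arbitrarily small, a strong D-function of norm at most `C * M + δ`, then functions satisfying
`P M` agree on `L` with strong D-functions of the same norm. -/
theorem exists_eqOn_of_step {P : ℝ → (X → ℝ) → Prop} {C : ℝ} (hC : 0 ≤ C)
    (hP : ∀ M f, P M f → ∀ x ∈ L, |f x| ≤ M)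
    (hstep : ∀ M f ε δ, 0 ≤ M → 0 < ε → 0 < δ → P M f →
      ∃ G, StrongDOff L G (C * M + δ) ∧ P ε (f - G))
    {M δ : ℝ} (hM : 0 ≤ M) (hδ : 0 < δ) (hf : P M f) :
    ∃ G, StrongDOff L G (C * M + δ) ∧ ∀ x ∈ L, G x = f x := by
  set η := δ / (2 * C + 3) with hη
  have hη0 : 0 < η := by positivity
  have hm0 : ∀ k : ℕ, 0 < η * (1 / 2) ^ k := fun k => by positivity
  obtain ⟨G₀, hG₀, hP₀⟩ := hstep M f (η * (1 / 2) ^ 0) η hM (hm0 0) hη0 hf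
  have hnext : ∀ (k : ℕ) (g : {g // P (η * (1 / 2) ^ k) g}),
      ∃ G, StrongDOff L G (C * (η * (1 / 2) ^ k) + η * (1 / 2) ^ k) ∧
        P (η * (1 / 2) ^ (k + 1)) (g.1 - G) := fun k g =>
    hstep _ _ _ _ (hm0 k).le (hm0 (k + 1)) (hm0 k) g.2
  choose G hG hPG using hnext
  let F : ∀ k : ℕ, {g // P (η * (1 / 2) ^ k) g} := fun k =>
    Nat.rec ⟨f - G₀, hP₀⟩ (fun k g => ⟨g.1 - G k g, hPG k g⟩) k
  have hF : ∀ k x, (F (k + 1)).1 x = (F k).1 x - G k (F k) x := fun k x => rfl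
  have hsum : HasSum (fun k : ℕ => C * (η * (1 / 2) ^ k) + η * (1 / 2) ^ k)
      (C * (η * 2) + η * 2) :=
    ((hasSum_geometric_two.mul_left η).mul_left C).add (hasSum_geometric_two.mul_left η)
  have hGk := fun k => hG k (F k)
  refine ⟨G₀ + fun x => ∑' k, G k (F k) x,
    (hG₀.add (of_hasSum hGk hsum)).mono subset_rfl (le_of_eq ?_), fun x hx => ?_⟩
  · rw [hη]; field_simp; ring
  · have hpart : ∀ N, ∑ k ∈ Finset.range N, G k (F k) x = (f x - G₀ x) - (F N).1 x := fun N => by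
      induction N with
      | zero => simp [F]
      | succ N ih => rw [Finset.sum_range_succ, ih, hF]; ring
    have hF0 : Tendsto (fun N => (F N).1 x) atTop (𝓝 0) := by
      refine squeeze_zero_norm (fun N => hP _ _ (F N).2 x hx) ?_
      simpa using (hasSum_geometric_two.mul_left η).summable.tendsto_atTop_zero
    have hlim := (hasSum_apply hGk hsum.summable x).tendsto_sum_nat
    simp only [hpart] at hlim
    have := tendsto_nhds_unique hlim (hF0.const_sub (f x - G₀ x))
    rw [Pi.add_apply, this]
    ring

end StrongDOff

/-- The points of `A` near which `f` varies by at least `ε` on `A`. -/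
def oscDerived {X : Type*} [TopologicalSpace X] (f : X → ℝ) (ε : ℝ) (A : Set X) : Set X :=
  {x ∈ A | ∀ V, IsOpen V → x ∈ V → ∃ y ∈ V ∩ A, ∃ z ∈ V ∩ A, ε ≤ |f y - f z|}

theorem iterate_subset_iterate {α : Type*} {F G : Set α → Set α} {A B : Set α}
    (hFA : ∀ S, F S ⊆ S) (hG : Monotone G) (hFG : ∀ S ⊆ A, F S ⊆ G S) (hAB : A ⊆ B) (n : ℕ) :
    F^[n] A ⊆ G^[n] B := by
  suffices F^[n] A ⊆ A ∧ F^[n] A ⊆ G^[n] B from this.2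
  induction n with
  | zero => exact ⟨subset_rfl, hAB⟩
  | succ n ih =>
    simp only [Function.iterate_succ_apply']
    exact ⟨(hFA _).trans ih.1, (hFG _ ih.1).trans (hG ih.2)⟩

theorem BddFun.bddAbove_image_abs_sub {X : Type*} {f : X → ℝ} (hf : BddFun f) (x : X)
    (V : Set X) :
    BddAbove ((fun y => |f y - f x|) '' V) := by
  obtain ⟨C, hC⟩ := hf
  refine ⟨C + C, ?_⟩
  rintro _ ⟨y, -, rfl⟩
  exact (abs_sub _ _).trans (add_le_add (hC y) (hC x))

section Oscillation

variable {X : Type*} [TopologicalSpace X] {f g : X → ℝ} {ε η : ℝ} {A B : Set X}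

theorem oscDerived_subset : oscDerived f ε A ⊆ A := fun _ hx => hx.1

theorem oscDerived_subset_of_le (h : η ≤ ε) : oscDerived f ε A ⊆ oscDerived f η A :=
  fun _ hx => ⟨hx.1, fun V hV hxV =>
    let ⟨y, hy, z, hz, hyz⟩ := hx.2 V hV hxV
    ⟨y, hy, z, hz, h.trans hyz⟩⟩

theorem oscDerived_monotone : Monotone (oscDerived f ε) := fun _ _ h _ hx =>
  ⟨h hx.1, fun V hV hxV =>
    let ⟨y, hy, z, hz, hyz⟩ := hx.2 V hV hxV
    ⟨y, ⟨hy.1, h hy.2⟩, z, ⟨hz.1, h hz.2⟩, hyz⟩⟩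

theorem exists_isOpen_of_notMem_oscDerived {x : X} (hx : x ∈ A) (h : x ∉ oscDerived f ε A) :
    ∃ V, IsOpen V ∧ x ∈ V ∧ ∀ y ∈ V ∩ A, ∀ z ∈ V ∩ A, |f y - f z| < ε := by
  by_contra! hV
  exact h ⟨hx, hV⟩

theorem oscDerived_sub_subset {W : Set X} (hW : IsOpen W) (hg : ContinuousOn g W)
    (hε : 0 < ε) (hA : A ⊆ W) : oscDerived (f - g) ε A ⊆ oscDerived f (ε / 2) A := by
  refine fun x hx => ⟨hx.1, fun V hV hxV => ?_⟩
  have hxW := hW.mem_nhds (hA hx.1)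
  obtain ⟨V', hV'sub, hV', hxV'⟩ := mem_nhds_iff.1
    ((hg.continuousAt hxW).eventually (Metric.ball_mem_nhds (g x) (by positivity : 0 < ε / 4)))
  obtain ⟨y, hy, z, hz, hyz⟩ := hx.2 (V ∩ V') (hV.inter hV') ⟨hxV, hxV'⟩
  refine ⟨y, ⟨hy.1.1, hy.2⟩, z, ⟨hz.1.1, hz.2⟩, ?_⟩
  have h1 : |g y - g x| < ε / 4 := hV'sub hy.1.2
  have h2 : |g z - g x| < ε / 4 := hV'sub hz.1.2
  have h3 : |(f - g) y - (f - g) z| ≤ |f y - f z| + (|g y - g x| + |g z - g x|) := by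
    have e : (f - g) y - (f - g) z = (f y - f z) - ((g y - g x) - (g z - g x)) := by
      simp only [Pi.sub_apply]; ring
    rw [e]
    exact (abs_sub _ _).trans (add_le_add_right (abs_sub _ _) _)
  linarith

theorem exists_forall_abs_sub_lt_of_losc_lt (hf : BddFun f) {x : X} (h : losc f x < ε) :
    ∃ V, IsOpen V ∧ x ∈ V ∧ ∀ y ∈ V, |f y - f x| < ε := by
  obtain ⟨_, ⟨V, hV, hxV, rfl⟩, hlt⟩ := exists_lt_of_csInf_lt
    (⟨_, univ, isOpen_univ, mem_univ x, rfl⟩ : Set.Nonempty {c | ∃ V : Set X, IsOpen V ∧ x ∈ V ∧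
      sSup ((fun y => |f y - f x|) '' V) = c}) h
  exact ⟨V, hV, hxV, fun y hy =>
    (le_csSup (hf.bddAbove_image_abs_sub x V) (mem_image_of_mem _ hy)).trans_lt hlt⟩

theorem BddFun.losc_le (hf : BddFun f) : ∃ C, ∀ x, losc f x ≤ C := by
  obtain ⟨C, hC⟩ := hf
  refine ⟨C + C, fun x => ?_⟩
  have h1 : losc f x ≤ sSup ((fun y => |f y - f x|) '' univ) := by
    refine csInf_le ⟨0, ?_⟩ ⟨univ, isOpen_univ, mem_univ x, rfl⟩
    rintro _ ⟨V, -, -, rfl⟩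
    refine Real.sSup_nonneg ?_
    rintro _ ⟨y, -, rfl⟩
    exact abs_nonneg _
  refine h1.trans (csSup_le ⟨_, x, mem_univ x, rfl⟩ ?_)
  rintro _ ⟨y, -, rfl⟩
  exact (abs_sub _ _).trans (add_le_add (hC y) (hC x))

theorem losc_lt_of_osc_lt (hf : BddFun f) {x : X} (h : osc f x < ε) : losc f x < ε := by
  obtain ⟨_, ⟨V, hV, hxV, rfl⟩, hlt⟩ := exists_lt_of_csInf_lt
    (⟨_, univ, isOpen_univ, mem_univ x, rfl⟩ : Set.Nonempty {c | ∃ V : Set X, IsOpen V ∧ x ∈ V ∧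
      sSup (losc f '' V) = c}) h
  obtain ⟨C, hC⟩ := hf.losc_le
  refine (le_csSup ⟨C, ?_⟩ (mem_image_of_mem _ hxV)).trans_lt hlt
  rintro _ ⟨y, -, rfl⟩
  exact hC y

theorem iterate_oscDerived_subset_osSet (hf : BddFun f) (U : Set X) (ε : ℝ) (n : ℕ) :
    (oscDerived f (2 * ε))^[n] U ⊆ Subtype.val '' osSet (U.domRestrict f) ε n := by
  induction n with
  | zero => simp [osSet]
  | succ n ih =>
    rw [Function.iterate_succ_apply']
    intro x hx
    obtain ⟨⟨x', hx', rfl⟩, hosc⟩ := oscDerived_monotone ih hx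
    refine ⟨x', ⟨hx', ?_⟩, rfl⟩
    by_contra! hlt
    have hb : BddFun ((osSet (U.domRestrict f) ε n).domRestrict (U.domRestrict f)) :=
      hf.imp fun C hC y => hC y
    obtain ⟨V, hV, hxV, hVlt⟩ :=
      exists_forall_abs_sub_lt_of_losc_lt hb (losc_lt_of_osc_lt hb hlt)
    obtain ⟨V₁, hV₁, rfl⟩ := isOpen_induced_iff.1 hV
    obtain ⟨V₂, hV₂, rfl⟩ := isOpen_induced_iff.1 hV₁
    obtain ⟨_, ⟨hyV, y, hy, rfl⟩, _, ⟨hzV, z, hz, rfl⟩, hyz⟩ := hosc V₂ hV₂ hxV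
    have h1 : |f y - f x'| < ε := hVlt ⟨y, hy⟩ hyV
    have h2 : |f z - f x'| < ε := hVlt ⟨z, hz⟩ hzV
    have h3 := abs_sub_le (f y) (f x') (f z)
    rw [abs_sub_comm (f x')] at h3
    linarith

theorem osSet_eq_empty_of_baireIndex_le {n : ℕ} (h : baireIndex f ≤ n) (hε : 0 < ε) :
    osSet f ε (n + 1) = ∅ := by
  by_contra hne
  have h1 : ((n + 1 : ℕ) : ℕ∞) ≤ oscIndex f ε :=
    le_iSup₂_of_le (n + 1) (nonempty_iff_ne_empty.2 hne) le_rfl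
  have h2 : oscIndex f ε ≤ baireIndex f := le_iSup₂_of_le ε hε le_rfl
  have h3 : n + 1 ≤ n := by exact_mod_cast h1.trans (h2.trans h)
  omega

end Oscillation

/-- On `L`, the function `f` is bounded by `M` and supported on a relatively open set on which
its oscillation index is less than `n`. -/
def OscLayered {X : Type*} [TopologicalSpace X] (L : Set X) (n : ℕ) (M : ℝ) (f : X → ℝ) : Prop :=
  ∃ Z ⊆ L, IsClosed Z ∧ (∀ x ∈ Z, f x = 0) ∧ (∀ x ∈ L, |f x| ≤ M) ∧
    ∀ ε > 0, (oscDerived f ε)^[n] (L \ Z) = ∅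

section Decomposition

theorem isClosed_union_oscDerived {X : Type*} [TopologicalSpace X] {L Z : Set X}
    (hL : IsClosed L) (hZ : IsClosed Z) (hZL : Z ⊆ L) (f : X → ℝ) (ε : ℝ) :
    IsClosed (Z ∪ oscDerived f ε (L \ Z)) := by
  refine ⟨isOpen_iff_mem_nhds.2 fun x hx => ?_⟩
  rw [mem_compl_iff, mem_union, not_or] at hx
  by_cases hxL : x ∈ L
  · obtain ⟨V, hV, hxV, hVlt⟩ :=
      exists_isOpen_of_notMem_oscDerived (mem_sdiff_of_mem hxL hx.1) hx.2
    filter_upwards [hV.mem_nhds hxV, hZ.isOpen_compl.mem_nhds hx.1] with y hyV hyZ hy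
    obtain ⟨a, ha, b, hb, hab⟩ := (hy.resolve_left hyZ).2 V hV hyV
    exact absurd hab (hVlt a ha b hb).not_ge
  · filter_upwards [hL.isOpen_compl.mem_nhds hxL] with y hyL hy
    exact hyL (hy.elim (fun h => hZL h) fun h => h.1.1)

variable {X : Type*} [PseudoMetricSpace X]

/-- Off a closed set containing all points of large oscillation, a bounded function on a closed
set is uniformly close to the restriction of a continuous function. -/
theorem exists_continuousOn_abs_sub_le {L Z : Set X} (hL : IsClosed L) {f : X → ℝ} {M ε : ℝ}
    (hM : 0 ≤ M) (hfM : ∀ x ∈ L, |f x| ≤ M)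
    (hosc : ∀ x ∈ L \ Z, ∃ V, IsOpen V ∧ x ∈ V ∧ ∀ y ∈ V ∩ (L \ Z), |f x - f y| < ε) :
    ∃ h : X → ℝ, ContinuousOn h Zᶜ ∧ (∀ x ∈ Zᶜ, |h x| ≤ M) ∧
      ∀ x ∈ L \ Z, |f x - h x| ≤ ε := by
  let t : (Zᶜ : Set X) → Set ℝ := fun x =>
    Metric.closedBall 0 M ∩ {c | x.1 ∈ L → c ∈ Metric.closedBall (f x) ε}
  have ht : ∀ x, Convex ℝ (t x) := fun x => by
    refine (convex_closedBall _ _).inter ?_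
    by_cases hx : x.1 ∈ L
    · simpa only [hx, true_imp_iff, ofPred_mem_eq] using convex_closedBall (f x) ε
    · simpa [hx] using convex_univ
  have hloc : ∀ x, ∃ c : ℝ, ∀ᶠ y in 𝓝 x, c ∈ t y := fun x => by
    by_cases hx : x.1 ∈ L
    · obtain ⟨V, hV, hxV, hVlt⟩ := hosc x.1 ⟨hx, x.2⟩
      refine ⟨f x, ?_⟩
      filter_upwards [(hV.preimage continuous_subtype_val).mem_nhds hxV] with y hy
      exact ⟨by simpa using hfM x.1 hx, fun hyL => (hVlt y ⟨hy, hyL, y.2⟩).le⟩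
    · refine ⟨0, ?_⟩
      filter_upwards [(hL.isOpen_compl.preimage continuous_subtype_val).mem_nhds hx] with y hy
      exact ⟨by simpa using hM, fun hyL => absurd hyL hy⟩
  obtain ⟨h, hh⟩ := exists_continuous_forall_mem_convex_of_local_const ht hloc
  classical
  have hval : ∀ x (hx : x ∈ Zᶜ), (if hx : x ∈ Zᶜ then h ⟨x, hx⟩ else 0) = h ⟨x, hx⟩ :=
    fun x hx => dif_pos hx
  refine ⟨fun x => if hx : x ∈ Zᶜ then h ⟨x, hx⟩ else 0, ?_, fun x hx => ?_, fun x hx => ?_⟩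
  · rw [continuousOn_iff_continuous_domRestrict]
    convert h.continuous using 1
    funext x
    exact hval x.1 x.2
  · simp only [hval x hx]
    simpa using (hh ⟨x, hx⟩).1
  · simp only [hval x hx.2]
    have := (hh ⟨x, hx.2⟩).2 hx.1
    rwa [mem_closedBall_iff_norm', Real.norm_eq_abs] at this

theorem OscLayered.exists_strongDOff_sub {n : ℕ}
    (ih : ∀ (L : Set X) (M : ℝ) (f : X → ℝ) (δ : ℝ), IsClosed L → 0 ≤ M → 0 < δ →
      OscLayered L n M f → ∃ G, StrongDOff L G ((2 ^ n - 1) * M + δ) ∧ ∀ x ∈ L, G x = f x)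
    {L : Set X} (hL : IsClosed L) {M : ℝ} {f : X → ℝ} {ε δ : ℝ} (hM : 0 ≤ M) (hε : 0 < ε)
    (hδ : 0 < δ) (hf : OscLayered L (n + 1) M f) :
    ∃ G, StrongDOff L G ((2 ^ (n + 1) - 1) * M + δ) ∧ OscLayered L (n + 1) ε (f - G) := by
  obtain ⟨Z, hZL, hZ, hf0, hfM, hind⟩ := hf
  set A := L \ Z with hA
  set Z' := Z ∪ oscDerived f ε A with hZ'
  have hZ'c : IsClosed Z' := isClosed_union_oscDerived hL hZ hZL f ε
  have hZ'L : Z' ⊆ L := union_subset hZL (oscDerived_subset.trans sdiff_subset)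
  have hLZ' : L \ Z' ⊆ A := sdiff_subset_sdiff_right subset_union_left
  have hlayer : OscLayered Z' n M f := by
    refine ⟨Z, subset_union_left, hZ, hf0, fun x hx => hfM x (hZ'L hx), fun ε' hε' => ?_⟩
    have hdiff : Z' \ Z = oscDerived f ε A := by
      rw [hZ', union_sdiff_left, sdiff_eq_left]
      exact disjoint_left.2 fun x hx hxZ => hx.1.2 hxZ
    rw [hdiff, ← subset_empty_iff, ← hind (min ε ε') (lt_min hε hε'),
      Function.iterate_succ_apply]
    exact iterate_subset_iterate (fun _ => oscDerived_subset) oscDerived_monotone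
      (fun _ _ => oscDerived_subset_of_le (min_le_right _ _))
      (oscDerived_subset_of_le (min_le_left _ _)) n
  obtain ⟨G, hG, hGf⟩ := ih Z' M f (δ / 2) hZ'c hM (half_pos hδ) hlayer
  obtain ⟨h, hhc, hhM, hfh⟩ := exists_continuousOn_abs_sub_le (Z := Z') hL hM hfM
    fun x hx => by
      obtain ⟨V, hV, hxV, hVlt⟩ := exists_isOpen_of_notMem_oscDerived (hLZ' hx)
        fun hx' => hx.2 (Or.inr hx')
      exact ⟨V, hV, hxV, fun y hy => hVlt x ⟨hxV, hLZ' hx⟩ y ⟨hy.1, hLZ' hy.2⟩⟩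
  set H := (Z'ᶜ).indicator fun x => h x - G x with hH
  have hHin : EqOn H (fun x => h x - G x) Z'ᶜ := fun x hx => indicator_of_mem hx _
  have hHout : ∀ x ∈ Z', H x = 0 := fun x hx => indicator_of_notMem (not_not.2 hx) _
  have hHbd : ∀ x, |H x| ≤ M + ((2 ^ n - 1) * M + δ / 2) := fun x => by
    by_cases hx : x ∈ Z'
    · rw [hHout x hx, abs_zero]
      linarith [(abs_nonneg (G x)).trans (hG.dBound.abs_le x)]
    · rw [hHin hx]
      exact (abs_sub _ _).trans (add_le_add (hhM x hx) (hG.dBound.abs_le x))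
  have hHs := StrongDOff.of_continuousOn hZ'c ((hhc.sub hG.continuousOn).congr hHin) hHout hHbd
  have hGH := hG.add hHs
  have hsub : ∀ x ∉ Z', (f - (G + H)) x = f x - h x := fun x hx => by
    rw [Pi.sub_apply, Pi.add_apply, hHin hx]; ring
  have hzero : ∀ x ∈ Z', (f - (G + H)) x = 0 := fun x hx => by
    rw [Pi.sub_apply, Pi.add_apply, hHout x hx, hGf x hx]; ring
  refine ⟨G + H, hGH.mono hZ'L (le_of_eq (by ring)), Z', hZ'L, hZ'c, hzero, fun x hx => ?_,
    fun ε' hε' => ?_⟩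
  · by_cases hx' : x ∈ Z'
    · rw [hzero x hx', abs_zero]; exact hε.le
    · rw [hsub x hx']; exact hfh x ⟨hx, hx'⟩
  · rw [← subset_empty_iff, ← hind (ε' / 2) (half_pos hε')]
    exact iterate_subset_iterate (fun _ => oscDerived_subset) oscDerived_monotone
      (fun S hS => oscDerived_sub_subset hZ'c.isOpen_compl hGH.continuousOn hε'
        (hS.trans fun x hx => hx.2)) hLZ' (n + 1)

theorem OscLayered.exists_strongDOff_eqOn (n : ℕ) :
    ∀ (L : Set X) (M : ℝ) (f : X → ℝ) (δ : ℝ), IsClosed L → 0 ≤ M → 0 < δ →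
      OscLayered L n M f → ∃ G, StrongDOff L G ((2 ^ n - 1) * M + δ) ∧ ∀ x ∈ L, G x = f x := by
  induction n with
  | zero =>
    rintro L M f δ - - hδ ⟨Z, -, -, hf0, -, hind⟩
    have hLZ : L ⊆ Z := sdiff_eq_empty.1 (hind 1 one_pos)
    exact ⟨0, StrongDOff.zero (by simpa using hδ.le), fun x hx => (hf0 x (hLZ hx)).symm⟩
  | succ n ih =>
    intro L M f δ hL hM hδ hf
    refine StrongDOff.exists_eqOn_of_step (P := OscLayered L (n + 1))
      (sub_nonneg.2 (one_le_pow₀ one_le_two)) ?_ ?_ hM hδ hf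
    · rintro M f ⟨Z, -, -, -, hfM, -⟩
      exact hfM
    · intro M f ε δ hM hε hδ hf
      exact hf.exists_strongDOff_sub ih hL hM hε hδ

end Decomposition

theorem DApprox.memSD {X : Type*} [PseudoMetricSpace X] {f : X → ℝ} {c : ℝ} (hf : DBound f c)
    (h : DApprox f) : MemSD f := by
  choose φ hφ hfφ using fun k : ℕ => h (1 / ((k : ℝ) + 1)) Nat.one_div_pos_of_nat
  refine ⟨φ, fun k => ⟨?_, hφ k⟩, squeeze_zero (fun k => DNorm_nonneg _)
    (fun k => (hfφ k).DNorm_le Nat.one_div_pos_of_nat.le) tendsto_one_div_add_atTop_nhds_zero_nat⟩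
  have := (hf.add (hfφ k).neg).memDBSC
  rwa [neg_sub, add_sub_cancel] at this

/-- **Theorem 2.6.** If `f` is bounded, supported on an open set `U`, and the
restriction `f|_U` has Baire index at most `n`, then `f ∈ SD(K)` and
`‖f‖_D ≤ (2^(n+1) - 1) ‖f‖_∞`. -/
theorem mem_SD_of_supported_finite_index {K : Type*} [MetricSpace K]
    [TopologicalSpace.SeparableSpace K] (n : ℕ) (f : K → ℝ) (hb : BddFun f)
    (U : Set K) (hU : IsOpen U) (hsupp : ∀ x ∉ U, f x = 0)
    (hind : baireIndex (U.restrict f) ≤ (n : ℕ∞)) :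
    MemSD f ∧ DNorm f ≤ (2 ^ (n + 1) - 1 : ℝ) * supNorm f := by
  have hM : ∀ x, |f x| ≤ supNorm f := fun x =>
    le_ciSup (f := fun x => |f x|) (hb.imp fun C hC => by rintro _ ⟨y, rfl⟩; exact hC y) x
  have hM0 : 0 ≤ supNorm f := Real.iSup_nonneg fun x => abs_nonneg _
  have hlayer : OscLayered univ (n + 1) (supNorm f) f := by
    refine ⟨Uᶜ, subset_univ _, hU.isClosed_compl, hsupp, fun x _ => hM x, fun ε hε => ?_⟩
    have := iterate_oscDerived_subset_osSet hb U (ε / 2) (n + 1)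
    have hos : osSet (U.domRestrict f) (ε / 2) (n + 1) = ∅ :=
      osSet_eq_empty_of_baireIndex_le hind (half_pos hε)
    rw [hos, image_empty, subset_empty_iff, mul_div_cancel₀ ε two_ne_zero] at this
    rwa [← compl_eq_univ_sdiff, compl_compl]
  have hrep : ∀ δ > 0, StrongDOff univ f ((2 ^ (n + 1) - 1) * supNorm f + δ) := fun δ hδ => by
    obtain ⟨G, hG, hGf⟩ :=
      OscLayered.exists_strongDOff_eqOn (n + 1) univ _ f δ isClosed_univ hM0 hδ hlayer
    rwa [funext fun x => hGf x (mem_univ x)] at hG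
  have hC : (0 : ℝ) ≤ 2 ^ (n + 1) - 1 := sub_nonneg.2 (one_le_pow₀ one_le_two)
  exact ⟨(hrep 1 one_pos).dApprox.memSD (hrep 1 one_pos).dBound,
    le_of_forall_pos_le_add fun δ hδ => (hrep δ hδ).dBound.DNorm_le (by positivity)⟩
end
end
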